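/- arXiv:math/0403060 — 2 statements merged into one kernel-verified Lean document; each statement's English description precedes it below -/
import Mathlib

section
/- For all integers x < y < z and every cookie environment ω ∈ Ω₊, the probability that the multi-excited random walk started at y hits x before it hits z satisfies P_{y,ω}[T_x < T_z] ≤ (z − y)/(z − x). In particular, T_z < ∞ holds P_{y,ω}-almost surely for every z ≥ y. -/
open MeasureTheory Filter Set Topology ProbabilityTheory
open scoped ENNReal ENat

noncomputable section

/-- A cookie environment: `ω z i` is the strength of the `(i+1)`-st cookie at site `z`
(cookies at each site are indexed by `i = 0, 1, 2, …`). -/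
abbrev CEnv : Type := ℤ → ℕ → ℝ

/-- `ω` belongs to `Ω₊`, i.e. all cookie strengths lie in `[1/2, 1]`. -/
def IsCookieEnv (ω : CEnv) : Prop := ∀ z i, ω z i ∈ Set.Icc (1/2 : ℝ) 1

/-- The number of visits of the path `x` to the site `x n` at times `m < n`. -/
def prevVisits (x : ℕ → ℤ) (n : ℕ) : ℕ :=
  ((Finset.range n).filter fun m => x m = x n).card

/-- The probability of the step from `x n` to `x (n+1)` for the multi-excited random
walk: jump to the right with the strength of the bottom remaining cookie at the current
site, to the left with the complementary probability. -/
def stepProb (ω : CEnv) (x : ℕ → ℤ) (n : ℕ) : ℝ :=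
  if x (n+1) = x n + 1 then ω (x n) (prevVisits x n)
  else if x (n+1) = x n - 1 then 1 - ω (x n) (prevVisits x n)
  else 0

/-- The probability that the walk started at `x0` follows the path `x` up to time `n`. -/
def cylProb (ω : CEnv) (x0 : ℤ) (x : ℕ → ℤ) (n : ℕ) : ℝ :=
  (if x 0 = x0 then 1 else 0) * ∏ m ∈ Finset.range n, stepProb ω x m

/-- `P` is the law `P_{x0,ω}` of the multi-excited random walk in the cookie
environment `ω` started at `x0`, characterized by its cylinder probabilities. -/
def IsERWLaw (ω : CEnv) (x0 : ℤ) (P : Measure (ℕ → ℤ)) : Prop :=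
  IsProbabilityMeasure P ∧
    ∀ (x : ℕ → ℤ) (n : ℕ),
      P {Y | ∀ m ≤ n, Y m = x m} = ENNReal.ofReal (cylProb ω x0 x n)

/-- First passage time `T_k`, with value `∞` if `k` is never visited. -/
def T (k : ℤ) (Y : ℕ → ℤ) : ℕ∞ :=
  sInf {t : ℕ∞ | ∃ n : ℕ, (n : ℕ∞) = t ∧ Y n = k}

/-- First passage time of an extended-real level, with the convention
`T_{−∞} = T_{+∞} = ∞`. -/
def Te (k : EReal) (Y : ℕ → ℤ) : ℕ∞ :=
  sInf {t : ℕ∞ | ∃ n : ℕ, (n : ℕ∞) = t ∧ ((Y n : ℝ) : EReal) = k}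

/-- `R_k`, the event that the site `k` is visited infinitely often. -/
def Rset (k : ℤ) : Set (ℕ → ℤ) := {Y | ∀ N : ℕ, ∃ n ≥ N, Y n = k}

/-- The number of visits of `Y` to the site `s` at times `< t`. -/
def visitsBefore (Y : ℕ → ℤ) (s : ℤ) (t : ℕ∞) : ℕ∞ :=
  {m : ℕ | (m : ℕ∞) < t ∧ Y m = s}.encard

/-- `D_t^s`: the total drift stored in the cookies consumed at the site `s`
before time `t` (a time in `ℕ∞`; `t = ∞` gives `D_∞^s`). -/
def driftAt (ω : CEnv) (Y : ℕ → ℤ) (s : ℤ) (t : ℕ∞) : ℝ≥0∞ :=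
  ∑' i : ℕ, Set.indicator {i : ℕ | (i : ℕ∞) < visitsBefore Y s t}
    (fun i => ENNReal.ofReal (2 * ω s i - 1)) i

/-- `D_t`: the total drift consumed before time `t` (at all sites). -/
def Dtot (ω : CEnv) (Y : ℕ → ℤ) (t : ℕ∞) : ℝ≥0∞ := ∑' s : ℤ, driftAt ω Y s t

/-- `D_t^+`: the total drift consumed at nonnegative sites before time `t`. -/
def DtotPos (ω : CEnv) (Y : ℕ → ℤ) (t : ℕ∞) : ℝ≥0∞ := ∑' s : ℕ, driftAt ω Y (s : ℤ) t

/-- `δ^s`: the total drift stored in the cookies at the site `s`. -/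
def cookieDrift (ω : CEnv) (s : ℤ) : ℝ≥0∞ := ∑' i : ℕ, ENNReal.ofReal (2 * ω s i - 1)

/-- The successive times `τ_{k,1}, τ_{k,2}, …` (indexed here from `0`) at which the
walk is at a site `≥ k`. -/
def tauT (k : ℤ) (Y : ℕ → ℤ) : ℕ → ℕ∞
  | 0 => sInf {t : ℕ∞ | ∃ n : ℕ, (n : ℕ∞) = t ∧ k ≤ Y n}
  | m + 1 => sInf {t : ℕ∞ | ∃ n : ℕ, (n : ℕ∞) = t ∧ tauT k Y m < (n : ℕ∞) ∧ k ≤ Y n}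

/-- The observed sequence `(X_{τ_{k,m}})_{m ≥ 1}` (indexed here from `0`). -/
def obsSeq (k : ℤ) (Y : ℕ → ℤ) (m : ℕ) : ℤ := Y (tauT k Y m).toNat

/-- The one-sided shift on sequences. -/
def shiftSeq {α : Type*} (u : ℕ → α) : ℕ → α := fun n => u (n + 1)

/-- The restriction `(ω(x))_{x ≥ 0}` of an environment to the nonnegative sites. -/
def restrictNN (ω : CEnv) : ℕ → ℕ → ℝ := fun x => ω (x : ℤ)

/-- `(ω(x))_{x ≥ 0}` is stationary under `Pr`: its law is invariant under the shift. -/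
def IsStationaryEnv (Pr : Measure CEnv) : Prop :=
  MeasurePreserving shiftSeq (Pr.map restrictNN) (Pr.map restrictNN)

/-- `(ω(x))_{x ≥ 0}` is stationary and ergodic under `Pr`. -/
def IsStatErgEnv (Pr : Measure CEnv) : Prop :=
  Ergodic shiftSeq (Pr.map restrictNN)

/-- The process `ξ_k = ((ω(x+k))_{x≥0}, (X_{τ_{k,m}} − k)_{m≥0})` consisting of the
environment to the right of `k` and the trajectory at sites `≥ k`, recentered at `k`. -/
def xiProc (p : CEnv × (ℕ → ℤ)) (k : ℕ) : (ℕ → ℕ → ℝ) × (ℕ → ℤ) :=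
  (fun x : ℕ => p.1 ((x : ℤ) + (k : ℤ)), fun m => obsSeq (k : ℤ) p.2 m - (k : ℤ))

lemma prevVisits_congr {X Y : ℕ → ℤ} {n : ℕ} (h : ∀ m ≤ n, X m = Y m) :
    prevVisits X n = prevVisits Y n := by
  unfold prevVisits
  congr 1
  apply Finset.filter_congr
  intro m hm
  rw [h m (Finset.mem_range.1 hm).le, h n le_rfl]

lemma stepProb_congr (ω : CEnv) {X Y : ℕ → ℤ} {n : ℕ} (h : ∀ m ≤ n + 1, X m = Y m) :
    stepProb ω X n = stepProb ω Y n := by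
  unfold stepProb
  rw [h (n + 1) le_rfl, h n n.le_succ,
    prevVisits_congr fun m hm => h m (hm.trans n.le_succ)]

lemma cylProb_congr (ω : CEnv) (x0 : ℤ) {X Y : ℕ → ℤ} {n : ℕ} (h : ∀ m ≤ n, X m = Y m) :
    cylProb ω x0 X n = cylProb ω x0 Y n := by
  unfold cylProb
  rw [h 0 n.zero_le]
  congr 1
  apply Finset.prod_congr rfl
  intro m hm
  have hmn := Finset.mem_range.1 hm
  exact stepProb_congr ω fun k hk => h k (by omega)

lemma cylProb_succ (ω : CEnv) (x0 : ℤ) (X : ℕ → ℤ) (n : ℕ) :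
    cylProb ω x0 X (n + 1) = cylProb ω x0 X n * stepProb ω X n := by
  simp only [cylProb, Finset.prod_range_succ, mul_assoc]

lemma cylProb_nonneg {ω : CEnv} (hω : IsCookieEnv ω) (x0 : ℤ) (X : ℕ → ℤ) (n : ℕ) :
    0 ≤ cylProb ω x0 X n := by
  unfold cylProb
  apply mul_nonneg (by split_ifs <;> norm_num)
  apply Finset.prod_nonneg
  intro m _
  have := hω (X m) (prevVisits X m)
  unfold stepProb
  split_ifs <;> linarith [this.1, this.2]

/-- The extension of a finite path to an infinite one which stays at its last site. -/
def frozenPath {n : ℕ} (c : Fin (n + 1) → ℤ) : ℕ → ℤ :=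
  fun m => c ⟨min m n, by omega⟩

lemma frozenPath_apply {n : ℕ} (c : Fin (n + 1) → ℤ) {m : ℕ} (hm : m ≤ n) :
    frozenPath c m = c ⟨m, by omega⟩ := by
  simp [frozenPath, hm]

/-- The first `n + 1` sites of a path. -/
def initialPath (n : ℕ) (Y : ℕ → ℤ) : Fin (n + 1) → ℤ := fun i => Y i

lemma measurable_initialPath (n : ℕ) : Measurable (initialPath n) :=
  measurable_pi_lambda _ fun i => measurable_pi_apply (i : ℕ)

/-- `V n` is a function of the first `n + 1` sites of the path, for all `n`. -/
def IsAdaptedFun (V : ℕ → (ℕ → ℤ) → ℝ≥0∞) : Prop :=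
  ∀ n X Y, (∀ m ≤ n, X m = Y m) → V n X = V n Y

/-- `V` decreases in mean under every nearest-neighbor step that goes right with
probability in `[1/2, 1]`. -/
def DecreasesInMean (V : ℕ → (ℕ → ℤ) → ℝ≥0∞) : Prop :=
  ∀ n (Y R L : ℕ → ℤ) (p : ℝ), 1 / 2 ≤ p → p ≤ 1 →
    (∀ m ≤ n, R m = Y m) → R (n + 1) = Y n + 1 →
    (∀ m ≤ n, L m = Y m) → L (n + 1) = Y n - 1 →
    ENNReal.ofReal p * V (n + 1) R + ENNReal.ofReal (1 - p) * V (n + 1) L ≤ V n Y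

section Law

variable {ω : CEnv} {y : ℤ} {P : Measure (ℕ → ℤ)} {V : ℕ → (ℕ → ℤ) → ℝ≥0∞}

lemma IsAdaptedFun.eq_comp (hV : IsAdaptedFun V) (n : ℕ) :
    V n = (fun c => V n (frozenPath c)) ∘ initialPath n := by
  funext Y
  apply hV
  intro m hm
  rw [frozenPath_apply _ hm]
  rfl

lemma IsAdaptedFun.measurable (hV : IsAdaptedFun V) (n : ℕ) : Measurable (V n) := by
  rw [hV.eq_comp n]
  exact (measurable_of_countable _).comp (measurable_initialPath n)

lemma IsERWLaw.lintegral_eq_tsum (hP : IsERWLaw ω y P) (hV : IsAdaptedFun V) (n : ℕ) :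
    ∫⁻ Y, V n Y ∂P = ∑' c : Fin (n + 1) → ℤ,
      V n (frozenPath c) * ENNReal.ofReal (cylProb ω y (frozenPath c) n) := by
  have h : ∫⁻ Y, V n Y ∂P
      = ∫⁻ c, V n (frozenPath c) ∂(P.map (initialPath n)) := by
    rw [lintegral_map (measurable_of_countable _) (measurable_initialPath n)]
    exact lintegral_congr fun Y => congrFun (hV.eq_comp n) Y
  rw [h, lintegral_countable']
  refine tsum_congr fun c => ?_
  rw [Measure.map_apply (measurable_initialPath n) (measurableSet_singleton c), ← hP.2]
  congr 2
  ext Y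
  simp only [mem_preimage, mem_singleton_iff, mem_ofPred_eq]
  constructor
  · rintro rfl m hm
    rw [frozenPath_apply _ hm]
    rfl
  · intro hY
    funext i
    have hi : (i : ℕ) ≤ n := by omega
    exact (hY i hi).trans (frozenPath_apply c hi)

lemma IsERWLaw.lintegral_succ_le (hω : IsCookieEnv ω) (hP : IsERWLaw ω y P)
    (hV : IsAdaptedFun V) (hd : DecreasesInMean V) (n : ℕ) :
    ∫⁻ Y, V (n + 1) Y ∂P ≤ ∫⁻ Y, V n Y ∂P := by
  rw [hP.lintegral_eq_tsum hV, hP.lintegral_eq_tsum hV,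
    ← (Fin.snocEquiv fun _ : Fin (n + 2) => ℤ).tsum_eq, ENNReal.tsum_prod', ENNReal.tsum_comm]
  refine ENNReal.tsum_le_tsum fun c => ?_
  set e : ℤ → ℕ → ℤ := fun k => frozenPath (Fin.snoc (α := fun _ => ℤ) c k : Fin (n + 2) → ℤ)
    with he
  have he_le : ∀ k, ∀ m ≤ n, e k m = frozenPath c m := by
    intro k m hm
    simp only [he]
    rw [frozenPath_apply _ hm, frozenPath_apply _ (hm.trans n.le_succ)]
    exact Fin.snoc_castSucc (α := fun _ => ℤ) k c ⟨m, by omega⟩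
  have he_last : ∀ k, e k (n + 1) = k := by
    intro k
    simp only [he]
    rw [frozenPath_apply _ le_rfl]
    exact Fin.snoc_last (α := fun _ => ℤ) k c
  set u := frozenPath c n
  set p := ω u (prevVisits (frozenPath c) n) with hp
  have hstep : ∀ k, stepProb ω (e k) n
      = if k = u + 1 then p else if k = u - 1 then 1 - p else 0 := by
    intro k
    rw [stepProb, he_last, he_le k n le_rfl, prevVisits_congr (he_le k)]
  have hpm := hω u (prevVisits (frozenPath c) n)
  have hcyl : ∀ k, ENNReal.ofReal (cylProb ω y (e k) (n + 1))
      = ENNReal.ofReal (cylProb ω y (frozenPath c) n) * ENNReal.ofReal (stepProb ω (e k) n) := by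
    intro k
    rw [cylProb_succ, cylProb_congr ω y (he_le k), ENNReal.ofReal_mul (cylProb_nonneg hω _ _ _)]
  change ∑' k, V (n + 1) (e k) * ENNReal.ofReal (cylProb ω y (e k) (n + 1)) ≤ _
  have hne : u + 1 ≠ u - 1 := by omega
  rw [tsum_eq_sum (s := {u + 1, u - 1}), Finset.sum_pair hne, hcyl, hcyl, hstep, hstep,
    if_pos rfl, if_neg hne.symm, if_pos rfl]
  · have key := hd n (frozenPath c) (e (u + 1)) (e (u - 1)) p hpm.1 hpm.2
      (he_le _) (he_last _) (he_le _) (he_last _)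
    calc _ = (ENNReal.ofReal p * V (n + 1) (e (u + 1))
            + ENNReal.ofReal (1 - p) * V (n + 1) (e (u - 1)))
            * ENNReal.ofReal (cylProb ω y (frozenPath c) n) := by ring
      _ ≤ _ := by gcongr
  · intro k hk
    simp only [Finset.mem_insert, Finset.mem_singleton, not_or] at hk
    rw [hcyl, hstep, if_neg hk.1, if_neg hk.2]
    simp

lemma IsERWLaw.ae_start (hP : IsERWLaw ω y P) : ∀ᵐ Y ∂P, Y 0 = y := by
  have := hP.1
  have h := hP.2 (fun _ => y) 0
  simp only [nonpos_iff_eq_zero, forall_eq, cylProb, if_true, Finset.range_zero,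
    Finset.prod_empty, mul_one, ENNReal.ofReal_one] at h
  have hm : MeasurableSet {Y : ℕ → ℤ | Y 0 = y} :=
    (measurableSet_singleton y).preimage (measurable_pi_apply 0)
  exact (prob_compl_eq_zero_iff hm).2 h

lemma IsERWLaw.lintegral_le (hω : IsCookieEnv ω) (hP : IsERWLaw ω y P)
    (hV : IsAdaptedFun V) (hd : DecreasesInMean V) (n : ℕ) :
    ∫⁻ Y, V n Y ∂P ≤ V 0 fun _ => y := by
  have := hP.1
  induction n with
  | zero =>
    rw [lintegral_congr_ae (g := fun _ => V 0 fun _ => y)]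
    · simp
    · filter_upwards [hP.ae_start] with Y hY
      refine hV 0 _ _ fun m hm => ?_
      rw [Nat.le_zero.1 hm, hY]
  | succ n ih => exact (hP.lintegral_succ_le hω hV hd n).trans ih

end Law

/-- The path makes only nearest-neighbor steps before time `n`. -/
def NearestNeighbor (Y : ℕ → ℤ) (n : ℕ) : Prop :=
  ∀ k < n, Y (k + 1) = Y k + 1 ∨ Y (k + 1) = Y k - 1

lemma NearestNeighbor.succ_of_eq {X Y : ℕ → ℤ} {n : ℕ} (h : ∀ m ≤ n, X m = Y m)
    (hY : NearestNeighbor Y n) (hs : X (n + 1) = Y n + 1 ∨ X (n + 1) = Y n - 1) :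
    NearestNeighbor X (n + 1) := by
  intro k hk
  rcases Nat.lt_succ_iff_lt_or_eq.1 hk with hk | rfl
  · rw [h (k + 1) hk, h k hk.le]
    exact hY k hk
  · rw [h k le_rfl]
    exact hs

lemma NearestNeighbor.congr {X Y : ℕ → ℤ} {n : ℕ} (h : ∀ m ≤ n, X m = Y m)
    (hX : NearestNeighbor X n) : NearestNeighbor Y n := by
  intro k hk
  rw [← h (k + 1) hk, ← h k hk.le]
  exact hX k hk

lemma IsERWLaw.ae_nearestNeighbor {ω : CEnv} (hω : IsCookieEnv ω) {y : ℤ}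
    {P : Measure (ℕ → ℤ)} (hP : IsERWLaw ω y P) : ∀ᵐ Y ∂P, ∀ n, NearestNeighbor Y n := by
  classical
  set V : ℕ → (ℕ → ℤ) → ℝ≥0∞ := fun n Y => if NearestNeighbor Y n then 0 else 1 with hVdef
  have hV : IsAdaptedFun V := by
    intro n X Y h
    have : NearestNeighbor X n ↔ NearestNeighbor Y n :=
      ⟨fun hX => hX.congr h, fun hY => hY.congr fun m hm => (h m hm).symm⟩
    simp only [hVdef, this]
  have hd : DecreasesInMean V := by
    intro n Y R L p hp hp1 hR hR1 hL hL1
    by_cases hY : NearestNeighbor Y n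
    · simp [hVdef, hY.succ_of_eq hR (Or.inl hR1), hY.succ_of_eq hL (Or.inr hL1)]
    · have hle : ∀ X, V (n + 1) X ≤ 1 := by
        intro X
        simp only [hVdef]
        split_ifs <;> simp
      have hVY : V n Y = 1 := by simp [hVdef, hY]
      calc _ ≤ ENNReal.ofReal p * 1 + ENNReal.ofReal (1 - p) * 1 := by gcongr <;> exact hle _
        _ = V n Y := by
          rw [mul_one, mul_one, ← ENNReal.ofReal_add (by linarith) (by linarith), hVY]
          simp
  rw [ae_all_iff]
  intro n
  have h0 : ∫⁻ Y, V n Y ∂P = 0 := by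
    refine le_antisymm ((hP.lintegral_le hω hV hd n).trans ?_) zero_le
    simp [hVdef, NearestNeighbor]
  filter_upwards [(lintegral_eq_zero_iff (hV.measurable n)).1 h0] with Y hY
  by_contra hc
  simp [hVdef, hc] at hY

/-- The path stays strictly between `x` and `z` up to time `n`. -/
def StaysIn (x z : ℤ) (Y : ℕ → ℤ) (n : ℕ) : Prop := ∀ k ≤ n, x < Y k ∧ Y k < z

/-- The path leaves the interval strictly between `x` and `z` at its lower end, by time `n`. -/
def ExitsBelow (x z : ℤ) (Y : ℕ → ℤ) (n : ℕ) : Prop :=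
  ∃ k ≤ n, Y k ≤ x ∧ ∀ j < k, x < Y j ∧ Y j < z

section Interval

variable {x z : ℤ} {X Y : ℕ → ℤ} {n : ℕ}

lemma StaysIn.congr (h : ∀ m ≤ n, X m = Y m) (hX : StaysIn x z X n) : StaysIn x z Y n := by
  intro k hk
  rw [← h k hk]
  exact hX k hk

lemma ExitsBelow.congr (h : ∀ m ≤ n, X m = Y m) (hX : ExitsBelow x z X n) :
    ExitsBelow x z Y n := by
  obtain ⟨k, hk, hkx, hj⟩ := hX
  refine ⟨k, hk, h k hk ▸ hkx, fun j hjk => ?_⟩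
  rw [← h j (hjk.le.trans hk)]
  exact hj j hjk

lemma StaysIn.of_succ (h : StaysIn x z Y (n + 1)) : StaysIn x z Y n :=
  fun k hk => h k (hk.trans n.le_succ)

lemma StaysIn.not_exitsBelow (h : StaysIn x z Y n) : ¬ ExitsBelow x z Y n := by
  rintro ⟨k, hk, hkx, -⟩
  exact absurd (h k hk).1 (not_lt.2 hkx)

lemma ExitsBelow.of_succ (h : ExitsBelow x z Y (n + 1)) :
    ExitsBelow x z Y n ∨ (StaysIn x z Y n ∧ Y (n + 1) ≤ x) := by
  obtain ⟨k, hk, hkx, hj⟩ := h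
  rcases Nat.le_succ_iff.1 hk with hk | rfl
  · exact Or.inl ⟨k, hk, hkx, hj⟩
  · exact Or.inr ⟨fun j hjn => hj j (by omega), hkx⟩

lemma exists_of_T_lt (h : T x Y < T z Y) : ∃ n, Y n = x ∧ ∀ m ≤ n, Y m ≠ z := by
  obtain ⟨t, ⟨n, rfl, hn⟩, ht⟩ := sInf_lt_iff.1 (show sInf _ < T z Y from h)
  refine ⟨n, hn, fun m hm hmz => ?_⟩
  have h1 : T z Y ≤ m := sInf_le ⟨m, rfl, hmz⟩
  have h2 : (m : ℕ∞) ≤ n := by exact_mod_cast hm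
  exact absurd ht (not_lt.2 (h1.trans h2))

lemma ne_of_T_eq_top (h : T z Y = ⊤) (n : ℕ) : Y n ≠ z := by
  intro hn
  have h1 : T z Y ≤ n := sInf_le ⟨n, rfl, hn⟩
  rw [h] at h1
  simp at h1

lemma T_lt_top_of_eq (h : Y n = x) : T x Y < ⊤ :=
  lt_of_le_of_lt (sInf_le ⟨n, rfl, h⟩) (ENat.natCast_lt_top n)

/-- A nearest-neighbor path started in the interval and avoiding its upper end up to time `n`
stays in the interval unless it exits below. -/
lemma staysIn_or_exitsBelow (h0 : x < Y 0 ∧ Y 0 < z) (hnn : NearestNeighbor Y n)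
    (hz : ∀ m ≤ n, Y m ≠ z) :
    StaysIn x z Y n ∨ ∃ m ≤ n, Y m = x ∧ ExitsBelow x z Y m := by
  induction n with
  | zero =>
    left
    intro k hk
    rwa [Nat.le_zero.1 hk]
  | succ n ih =>
    rcases ih (fun k hk => hnn k (by omega)) (fun m hm => hz m (by omega)) with h | ⟨m, hm, h⟩
    · have hn := h n le_rfl
      have hs := hnn n (by omega)
      have hzn := hz (n + 1) le_rfl
      by_cases hx : Y (n + 1) = x
      · exact Or.inr ⟨n + 1, le_rfl, hx, n + 1, le_rfl, hx.le, fun j hj => h j (by omega)⟩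
      · left
        intro k hk
        rcases Nat.lt_succ_iff_lt_or_eq.1 (Nat.lt_succ_of_le hk) with hk | rfl
        · exact h k (Nat.le_of_lt_succ hk)
        · omega
    · exact Or.inr ⟨m, by omega, h⟩

end Interval

lemma ofReal_mul_add_ofReal_mul_le {p a b c : ℝ} {A B : ℝ≥0∞} (hp : 0 ≤ p) (hp1 : p ≤ 1)
    (ha : 0 ≤ a) (hb : 0 ≤ b) (hA : A ≤ ENNReal.ofReal a) (hB : B ≤ ENNReal.ofReal b)
    (h : p * a + (1 - p) * b ≤ c) :
    ENNReal.ofReal p * A + ENNReal.ofReal (1 - p) * B ≤ ENNReal.ofReal c := by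
  have hq : 0 ≤ 1 - p := by linarith
  calc _ ≤ ENNReal.ofReal p * ENNReal.ofReal a + ENNReal.ofReal (1 - p) * ENNReal.ofReal b := by
        gcongr
    _ = ENNReal.ofReal (p * a + (1 - p) * b) := by
        rw [← ENNReal.ofReal_mul hp, ← ENNReal.ofReal_mul hq,
          ← ENNReal.ofReal_add (by positivity) (by positivity)]
    _ ≤ _ := ENNReal.ofReal_le_ofReal h

lemma IsERWLaw.measure_exitsBelow_le {ω : CEnv} (hω : IsCookieEnv ω) {x y z : ℤ}
    (hxy : x < y) (hyz : y < z) {P : Measure (ℕ → ℤ)} (hP : IsERWLaw ω y P) (n : ℕ) :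
    P {Y | ExitsBelow x z Y n} ≤ ENNReal.ofReal (((z : ℝ) - y) / ((z : ℝ) - x)) := by
  classical
  have hxz : (0 : ℝ) < z - x := by
    have : (x : ℝ) < z := by exact_mod_cast hxy.trans hyz
    linarith
  set V : ℕ → (ℕ → ℤ) → ℝ≥0∞ := fun n Y =>
    if ExitsBelow x z Y n then 1 else
      if StaysIn x z Y n then ENNReal.ofReal (((z : ℝ) - Y n) / ((z : ℝ) - x)) else 0 with hVdef
  have hV : IsAdaptedFun V := by
    intro n X Y h
    have h' : ∀ m ≤ n, Y m = X m := fun m hm => (h m hm).symm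
    have h1 : ExitsBelow x z X n ↔ ExitsBelow x z Y n :=
      ⟨fun hX => hX.congr h, fun hY => hY.congr h'⟩
    have h2 : StaysIn x z X n ↔ StaysIn x z Y n :=
      ⟨fun hX => hX.congr h, fun hY => hY.congr h'⟩
    simp only [hVdef, h1, h2, h n le_rfl]
  have hin : ∀ n (X Y : ℕ → ℤ), (∀ m ≤ n, X m = Y m) → StaysIn x z Y n →
      x ≤ X (n + 1) → V (n + 1) X ≤ ENNReal.ofReal (((z : ℝ) - X (n + 1)) / ((z : ℝ) - x)) := by
    intro n X Y h hY hx
    have hX : StaysIn x z X n := hY.congr fun m hm => (h m hm).symm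
    by_cases hE : ExitsBelow x z X (n + 1)
    · rcases hE.of_succ with hE' | ⟨-, hle⟩
      · exact absurd hE' hX.not_exitsBelow
      · rw [le_antisymm hle hx, div_self hxz.ne']
        simp [hVdef, hE]
    · simp only [hVdef, hE, if_false]
      split_ifs
      · exact le_rfl
      · exact zero_le
  have hout : ∀ n (X Y : ℕ → ℤ), (∀ m ≤ n, X m = Y m) → ¬ StaysIn x z Y n →
      V (n + 1) X ≤ if ExitsBelow x z Y n then 1 else 0 := by
    intro n X Y h hY
    have hX : ¬ StaysIn x z X n := fun hX => hY (hX.congr h)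
    have hX' : ¬ StaysIn x z X (n + 1) := fun hs => hX hs.of_succ
    by_cases hE : ExitsBelow x z X (n + 1)
    · rcases hE.of_succ with hE' | ⟨hs, -⟩
      · simp [hVdef, hE, hE'.congr h]
      · exact absurd hs hX
    · simp [hVdef, hE, hX']
  have hd : DecreasesInMean V := by
    intro n Y R L p hp hp1 hR hR1 hL hL1
    by_cases hY : StaysIn x z Y n
    · have hVY : V n Y = ENNReal.ofReal (((z : ℝ) - Y n) / ((z : ℝ) - x)) := by
        simp [hVdef, hY, hY.not_exitsBelow]
      obtain ⟨h1, h2⟩ := hY n le_rfl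
      have h2' : (Y n : ℝ) + 1 ≤ z := by exact_mod_cast h2
      have hRV := hin n R Y hR hY (by omega)
      have hLV := hin n L Y hL hY (by omega)
      rw [hR1] at hRV
      rw [hL1] at hLV
      push_cast at hRV hLV
      rw [hVY]
      refine ofReal_mul_add_ofReal_mul_le (by linarith) hp1
        (div_nonneg (by linarith) hxz.le) (div_nonneg (by linarith) hxz.le) hRV hLV ?_
      rw [mul_div_assoc', mul_div_assoc', ← add_div]
      gcongr
      nlinarith
    · have hVY : V n Y = if ExitsBelow x z Y n then 1 else 0 := by simp [hVdef, hY]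
      calc _ ≤ ENNReal.ofReal p * V n Y + ENNReal.ofReal (1 - p) * V n Y := by
            rw [hVY]
            gcongr
            · exact hout n R Y hR hY
            · exact hout n L Y hL hY
        _ = V n Y := by
          rw [← add_mul, ← ENNReal.ofReal_add (by linarith) (by linarith)]
          simp
  have h0 : V 0 (fun _ => y) ≤ ENNReal.ofReal (((z : ℝ) - y) / ((z : ℝ) - x)) := by
    have hs : StaysIn x z (fun _ => y) 0 := fun _ _ => ⟨hxy, hyz⟩
    simp [hVdef, hs, hs.not_exitsBelow]
  calc P {Y | ExitsBelow x z Y n} ≤ P {Y | 1 ≤ V n Y} := by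
        refine measure_mono fun Y hY => ?_
        have hY' : ExitsBelow x z Y n := hY
        simp [hVdef, hY']
    _ = 1 * P {Y | 1 ≤ V n Y} := (one_mul _).symm
    _ ≤ ∫⁻ Y, V n Y ∂P := mul_meas_ge_le_lintegral (hV.measurable n) 1
    _ ≤ V 0 (fun _ => y) := hP.lintegral_le hω hV hd n
    _ ≤ _ := h0

lemma IsERWLaw.measure_forall_staysIn {ω : CEnv} (hω : IsCookieEnv ω) {x y z : ℤ}
    {P : Measure (ℕ → ℤ)} (hP : IsERWLaw ω y P) :
    P {Y | ∀ n, StaysIn x z Y n} = 0 := by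
  classical
  set V : ℕ → (ℕ → ℤ) → ℝ≥0∞ := fun n Y =>
    if StaysIn x z Y n then ENNReal.ofReal (((z : ℝ) - x) ^ 2 - ((Y n : ℝ) - x) ^ 2 + n)
    else 0 with hVdef
  have hV : IsAdaptedFun V := by
    intro n X Y h
    have h' : ∀ m ≤ n, Y m = X m := fun m hm => (h m hm).symm
    have h2 : StaysIn x z X n ↔ StaysIn x z Y n :=
      ⟨fun hX => hX.congr h, fun hY => hY.congr h'⟩
    simp only [hVdef, h2, h n le_rfl]
  have hle : ∀ n Y, V n Y ≤ ENNReal.ofReal (((z : ℝ) - x) ^ 2 - ((Y n : ℝ) - x) ^ 2 + n) := by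
    intro n Y
    simp only [hVdef]
    split_ifs
    · exact le_rfl
    · exact zero_le
  have hd : DecreasesInMean V := by
    intro n Y R L p hp hp1 hR hR1 hL hL1
    by_cases hY : StaysIn x z Y n
    · have hVY : V n Y = ENNReal.ofReal (((z : ℝ) - x) ^ 2 - ((Y n : ℝ) - x) ^ 2 + n) := by
        simp [hVdef, hY]
      obtain ⟨h1, h2⟩ := hY n le_rfl
      have h1' : (x : ℝ) + 1 ≤ Y n := by exact_mod_cast h1
      have h2' : (Y n : ℝ) + 1 ≤ z := by exact_mod_cast h2
      have hn : (0 : ℝ) ≤ n := n.cast_nonneg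
      have hRV := hle (n + 1) R
      have hLV := hle (n + 1) L
      rw [hR1] at hRV
      rw [hL1] at hLV
      push_cast at hRV hLV
      rw [hVY]
      refine ofReal_mul_add_ofReal_mul_le (by linarith) hp1 ?_ ?_ hRV hLV ?_
      · nlinarith
      · nlinarith
      · nlinarith
    · have hz : ∀ X : ℕ → ℤ, (∀ m ≤ n, X m = Y m) → V (n + 1) X = 0 := by
        intro X h
        have hX : ¬ StaysIn x z X (n + 1) := fun hs => hY (hs.of_succ.congr h)
        simp [hVdef, hX]
      simp [hz R hR, hz L hL]
  have hbound : ∀ n : ℕ, (n : ℝ≥0∞) * P {Y | ∀ n, StaysIn x z Y n} ≤ V 0 fun _ => y := by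
    intro n
    calc (n : ℝ≥0∞) * P {Y | ∀ n, StaysIn x z Y n} ≤ n * P {Y | (n : ℝ≥0∞) ≤ V n Y} := by
          gcongr
          intro hY
          have hs := hY n
          simp only [hVdef, hs, if_true]
          rw [← ENNReal.ofReal_natCast]
          apply ENNReal.ofReal_le_ofReal
          obtain ⟨h1, h2⟩ := hs n le_rfl
          have h1' : (x : ℝ) < _ := Int.cast_lt.2 h1
          have h2' : _ < (z : ℝ) := Int.cast_lt.2 h2
          nlinarith
      _ ≤ ∫⁻ Y, V n Y ∂P := mul_meas_ge_le_lintegral (hV.measurable n) _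
      _ ≤ _ := hP.lintegral_le hω hV hd n
  by_contra hne
  have htop : V 0 (fun _ => y) = ⊤ := by
    rw [eq_top_iff, ← ENNReal.top_mul hne, ← ENNReal.iSup_natCast, ENNReal.iSup_mul]
    exact iSup_le hbound
  exact absurd htop (ne_top_of_le_ne_top ENNReal.ofReal_ne_top (hle 0 _))

lemma IsERWLaw.measure_T_lt_T_le {ω : CEnv} (hω : IsCookieEnv ω) {x y z : ℤ}
    (hxy : x < y) (hyz : y < z) {P : Measure (ℕ → ℤ)} (hP : IsERWLaw ω y P) :
    P {Y | T x Y < T z Y} ≤ ENNReal.ofReal (((z : ℝ) - y) / ((z : ℝ) - x)) := by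
  have hmono : Monotone fun n => {Y | ExitsBelow x z Y n} := by
    rintro m n hmn Y ⟨k, hk, h⟩
    exact ⟨k, hk.trans hmn, h⟩
  calc P {Y | T x Y < T z Y} ≤ P (⋃ n, {Y | ExitsBelow x z Y n}) := by
        apply measure_mono_ae
        filter_upwards [hP.ae_start, hP.ae_nearestNeighbor hω] with Y h0 hnn hT
        obtain ⟨n, hn, hz⟩ := exists_of_T_lt hT
        rcases staysIn_or_exitsBelow (x := x) (by rw [h0]; exact ⟨hxy, hyz⟩) (hnn n) hz with
          h | ⟨m, -, -, h⟩
        · exact absurd hn (h n le_rfl).1.ne'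
        · exact mem_iUnion.2 ⟨m, h⟩
    _ = ⨆ n, P {Y | ExitsBelow x z Y n} := hmono.measure_iUnion
    _ ≤ _ := iSup_le fun n => hP.measure_exitsBelow_le hω hxy hyz n

lemma IsERWLaw.measure_T_eq_top {ω : CEnv} (hω : IsCookieEnv ω) {y z : ℤ} (hyz : y < z)
    {P : Measure (ℕ → ℤ)} (hP : IsERWLaw ω y P) : P {Y | T z Y = ⊤} = 0 := by
  have hb : ∀ n : ℕ, P {Y | T z Y = ⊤}
      ≤ ENNReal.ofReal (((z : ℝ) - y) / ((z : ℝ) - (y - (n + 1)))) := by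
    intro n
    have hxy : y - ((n : ℤ) + 1) < y := by omega
    have h := hP.measure_T_lt_T_le hω hxy hyz
    push_cast at h
    refine le_trans ?_ h
    rw [← add_zero (P {Y | T (y - ((n : ℤ) + 1)) Y < T z Y}),
      ← hP.measure_forall_staysIn (x := y - ((n : ℤ) + 1)) (z := z) hω]
    refine le_trans (measure_mono_ae ?_) (measure_union_le _ _)
    filter_upwards [hP.ae_start, hP.ae_nearestNeighbor hω] with Y h0 hnn hT
    by_cases hs : ∀ k, StaysIn (y - ((n : ℤ) + 1)) z Y k
    · exact Or.inr hs
    · left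
      obtain ⟨k, hk⟩ := not_forall.1 hs
      obtain ⟨m, -, hm, -⟩ := (staysIn_or_exitsBelow (x := y - ((n : ℤ) + 1))
        (by rw [h0]; exact ⟨hxy, hyz⟩) (hnn k)
        (fun m _ => ne_of_T_eq_top hT m)).resolve_left hk
      change _ < T z Y
      rw [show T z Y = ⊤ from hT]
      exact T_lt_top_of_eq hm
  have hlim : Tendsto (fun n : ℕ => ENNReal.ofReal (((z : ℝ) - y) / ((z : ℝ) - (y - (n + 1)))))
      atTop (𝓝 0) := by
    rw [← ENNReal.ofReal_zero]
    apply ENNReal.tendsto_ofReal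
    apply Tendsto.const_div_atTop
    have h := tendsto_atTop_add_const_left atTop ((z : ℝ) - y + 1)
      (tendsto_natCast_atTop_atTop (R := ℝ))
    refine h.congr fun n => ?_
    ring
  exact le_antisymm (ge_of_tendsto' hlim hb) zero_le

/-- Lemma 1 of Zerner, *Multi-excited random walks on integers*.
For `x < y < z` and `ω ∈ Ω₊`, `P_{y,ω}[T_x < T_z] ≤ (z−y)/(z−x)`; in particular
`T_{z'} < ∞` holds `P_{y,ω}`-a.s. for every `z' ≥ y`. -/
theorem erw_exit_estimate (ω : CEnv) (hω : IsCookieEnv ω)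
    (x y z : ℤ) (hxy : x < y) (hyz : y < z)
    (P : Measure (ℕ → ℤ)) (hP : IsERWLaw ω y P) :
    P {Y | T x Y < T z Y} ≤ ENNReal.ofReal (((z : ℝ) - y) / ((z : ℝ) - x)) ∧
      ∀ z' : ℤ, y ≤ z' → P {Y | T z' Y = ⊤} = 0 := by
  refine ⟨hP.measure_T_lt_T_le hω hxy hyz, fun z' hz' => ?_⟩
  rcases hz'.eq_or_lt with rfl | hlt
  · refine measure_mono_null (fun Y hY => ?_) hP.ae_start
    exact ne_of_T_eq_top hY 0
  · exact hP.measure_T_eq_top hω hlt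

end
end

section
/- For all integers x, y, z with y < z and every cookie environment ω ∈ Ω₊, one has P_{x,ω}-almost surely R_y ⊆ R_z; that is, if the walk visits y infinitely often then it also visits z infinitely often. -/
open MeasureTheory Filter Set Topology ProbabilityTheory
open scoped ENNReal ENat

noncomputable section

/-- A walk at `y` steps to `y + 1` with conditional probability at least `1/2` given its
history. -/
lemma measure_cylinder_le_two_mul {ω : CEnv} (hω : IsCookieEnv ω) {x₀ : ℤ}
    {P : Measure (ℕ → ℤ)} (hP : IsERWLaw ω x₀ P) (x : ℕ → ℤ) (n : ℕ) :
    P {Y | ∀ m ≤ n, Y m = x m} ≤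
      2 * P ({Y | ∀ m ≤ n, Y m = x m} ∩ {Y | Y (n + 1) = x n + 1}) := by
  set x' := Function.update x (n + 1) (x n + 1) with hx'
  have hle : ∀ m ≤ n, x' m = x m := fun m hm => Function.update_of_ne (by omega) _ _
  have hlast : x' (n + 1) = x n + 1 := Function.update_self _ _ _
  have hcyl : {Y : ℕ → ℤ | ∀ m ≤ n, Y m = x m} = {Y | ∀ m ≤ n, Y m = x' m} := by
    ext Y
    exact forall₂_congr fun m hm => by rw [hle m hm]
  have hcyl_succ : {Y : ℕ → ℤ | ∀ m ≤ n, Y m = x m} ∩ {Y | Y (n + 1) = x n + 1} =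
      {Y | ∀ m ≤ n + 1, Y m = x' m} := by
    ext Y
    simp only [hcyl, ← hlast, mem_inter_iff, mem_ofPred_eq]
    refine ⟨fun h m hm => ?_, fun h => ⟨fun m hm => h m (by omega), h _ le_rfl⟩⟩
    rcases Nat.le_succ_iff.1 hm with h' | rfl
    exacts [h.1 m h', h.2]
  have hstep : stepProb ω x' n = ω (x' n) (prevVisits x' n) := by
    rw [stepProb, if_pos (by rw [hlast, hle n le_rfl])]
  have hprob : cylProb ω x₀ x' (n + 1) = cylProb ω x₀ x' n * stepProb ω x' n := by
    rw [cylProb, cylProb, Finset.prod_range_succ, mul_assoc]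
  rw [hcyl_succ, hcyl, hP.2, hP.2, hprob, hstep, ← ENNReal.ofReal_ofNat 2,
    ← ENNReal.ofReal_mul zero_le_two]
  have hhalf := (hω (x' n) (prevVisits x' n)).1
  rcases le_total (cylProb ω x₀ x' n) 0 with h | h
  · simp [ENNReal.ofReal_of_nonpos h]
  · exact ENNReal.ofReal_le_ofReal (by nlinarith)

lemma measurableSet_eval_eq (n : ℕ) (a : ℤ) : MeasurableSet {Y : ℕ → ℤ | Y n = a} :=
  measurableSet_eq_fun (measurable_pi_apply n) measurable_const

lemma measurableSet_cylinder (x : ℕ → ℤ) (n : ℕ) :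
    MeasurableSet {Y : ℕ → ℤ | ∀ m ≤ n, Y m = x m} := by
  simp only [ofPred_forall]
  exact .iInter fun m => .iInter fun _ => measurableSet_eval_eq m (x m)

lemma lintegral_le_of_forall_cylinder (P : Measure (ℕ → ℤ)) (n : ℕ) (f g : (ℕ → ℤ) → ℝ≥0∞)
    (h : ∀ x : ℕ → ℤ, ∫⁻ Y in {Y | ∀ m ≤ n, Y m = x m}, g Y ∂P ≤
      ∫⁻ Y in {Y | ∀ m ≤ n, Y m = x m}, f Y ∂P) :
    ∫⁻ Y, g Y ∂P ≤ ∫⁻ Y, f Y ∂P := by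
  let extend : (Fin (n + 1) → ℤ) → ℕ → ℤ := fun u m => if hm : m < n + 1 then u ⟨m, hm⟩ else 0
  let C : (Fin (n + 1) → ℤ) → Set (ℕ → ℤ) := fun u => {Y | ∀ m ≤ n, Y m = extend u m}
  have hC : ∀ u Y, Y ∈ C u ↔ u = fun i : Fin (n + 1) => Y i := by
    intro u Y
    refine ⟨fun hY => funext fun i => ?_, ?_⟩
    · simpa only [extend, dif_pos i.2] using (hY i (Nat.le_of_lt_succ i.2)).symm
    · rintro rfl m hm
      simp only [extend, dif_pos (Nat.lt_succ_of_le hm)]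
  have hdisj : Pairwise (Function.onFun Disjoint C) := fun u v huv =>
    Set.disjoint_left.2 fun Y hu hv => huv (((hC u Y).1 hu).trans ((hC v Y).1 hv).symm)
  have hunion : ⋃ u, C u = univ := eq_univ_of_forall fun Y => mem_iUnion.2 ⟨_, (hC _ Y).2 rfl⟩
  have hmeas : ∀ u, MeasurableSet (C u) := fun u => measurableSet_cylinder _ n
  rw [← setLIntegral_univ g, ← setLIntegral_univ f, ← hunion, lintegral_iUnion hmeas hdisj,
    lintegral_iUnion hmeas hdisj]
  exact ENNReal.tsum_le_tsum fun u => h _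

/-- Doubling the stake at time `n` when at `y`, and losing it upon a step to `y + 1`, does not
increase the expected value of the stake. -/
lemma lintegral_bet_le {ω : CEnv} (hω : IsCookieEnv ω) {x₀ : ℤ} {P : Measure (ℕ → ℤ)}
    (hP : IsERWLaw ω x₀ P) (y : ℤ) (n : ℕ) (f : (ℕ → ℤ) → ℝ≥0∞)
    (hf : ∀ Y Y' : ℕ → ℤ, (∀ m ≤ n, Y m = Y' m) → f Y = f Y') :
    ∫⁻ Y, (if Y n = y then (if Y (n + 1) = y + 1 then 0 else 2 * f Y) else f Y) ∂P ≤
      ∫⁻ Y, f Y ∂P := by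
  have := hP.1
  refine lintegral_le_of_forall_cylinder P n _ _ fun x => ?_
  set C := {Y : ℕ → ℤ | ∀ m ≤ n, Y m = x m} with hCdef
  have hC : MeasurableSet C := measurableSet_cylinder x n
  by_cases hxy : x n = y
  · set B := {Y : ℕ → ℤ | Y (n + 1) = y + 1} with hBdef
    have hB : MeasurableSet B := measurableSet_eval_eq (n + 1) (y + 1)
    have hlhs : ∫⁻ Y in C, (if Y n = y then (if Y (n + 1) = y + 1 then 0 else 2 * f Y)
        else f Y) ∂P = ∫⁻ Y in C, Bᶜ.indicator (fun _ => 2 * f x) Y ∂P := by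
      refine setLIntegral_congr_fun hC fun Y hY => ?_
      by_cases hYB : Y (n + 1) = y + 1 <;>
        simp [hBdef, hYB, (hY n le_rfl).trans hxy, hf Y x hY]
    have hrhs : ∫⁻ Y in C, f Y ∂P = ∫⁻ _ in C, f x ∂P :=
      setLIntegral_congr_fun hC fun Y hY => hf Y x hY
    rw [hlhs, hrhs, lintegral_indicator_const hB.compl, setLIntegral_const,
      Measure.restrict_apply hB.compl, mul_comm 2, mul_assoc, inter_comm, ← Set.sdiff_eq]
    gcongr
    have hle : P C ≤ 2 * P (C ∩ B) := by
      simpa only [hxy] using measure_cylinder_le_two_mul hω hP x n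
    have hsum := measure_inter_add_sdiff (μ := P) C hB
    have hfin : P (C ∩ B) ≠ ∞ := measure_ne_top _ _
    have hle' : P (C \ B) ≤ P (C ∩ B) := by
      rw [← hsum, two_mul] at hle
      exact (ENNReal.add_le_add_iff_left hfin).1 hle
    rw [two_mul, ← hsum]
    gcongr
  · refine (setLIntegral_congr_fun hC fun Y hY => ?_).le
    simp [(hY n le_rfl).trans_ne hxy]

/-- The stake after betting, at each visit to `y` among the `k` times from `N` on, double or
nothing against a step to `y + 1`. -/
def stake (y : ℤ) (N : ℕ) : ℕ → (ℕ → ℤ) → ℝ≥0∞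
  | 0, _ => 1
  | k + 1, Y =>
    if Y (N + k) = y then (if Y (N + k + 1) = y + 1 then 0 else 2 * stake y N k Y)
    else stake y N k Y

lemma stake_congr (y : ℤ) (N k : ℕ) (Y Y' : ℕ → ℤ) (h : ∀ m ≤ N + k, Y m = Y' m) :
    stake y N k Y = stake y N k Y' := by
  induction k with
  | zero => rfl
  | succ k ih =>
    simp only [stake]
    rw [ih fun m hm => h m (by omega), h (N + k) (by omega), h (N + k + 1) (by omega)]

lemma measurable_stake (y : ℤ) (N k : ℕ) : Measurable (stake y N k) := by
  induction k with
  | zero => exact measurable_const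
  | succ k ih =>
    exact .ite (measurableSet_eval_eq (N + k) y)
      (.ite (measurableSet_eval_eq (N + k + 1) (y + 1))
        measurable_const (ih.const_mul 2)) ih

lemma lintegral_stake_le_one {ω : CEnv} (hω : IsCookieEnv ω) {x₀ : ℤ} {P : Measure (ℕ → ℤ)}
    (hP : IsERWLaw ω x₀ P) (y : ℤ) (N k : ℕ) : ∫⁻ Y, stake y N k Y ∂P ≤ 1 := by
  have := hP.1
  induction k with
  | zero => simp [stake]
  | succ k ih => exact (lintegral_bet_le hω hP y (N + k) _ (stake_congr y N k)).trans ih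

lemma tendsto_stake_top {y : ℤ} {N : ℕ} {Y : ℕ → ℤ} (hy : Y ∈ Rset y)
    (hN : ∀ n ≥ N, Y n ≠ y + 1) : Tendsto (fun k => stake y N k Y) atTop (𝓝 ∞) := by
  have hsucc : ∀ k, stake y N (k + 1) Y =
      if Y (N + k) = y then 2 * stake y N k Y else stake y N k Y := by
    intro k
    simp only [stake]
    rw [if_neg (hN (N + k + 1) (by omega))]
  have hmono : Monotone fun k => stake y N k Y := by
    refine monotone_nat_of_le_succ fun k => ?_
    rw [hsucc]
    split_ifs
    · rw [two_mul]
      exact le_self_add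
    · exact le_rfl
  have hunbdd : ∀ j : ℕ, ∃ k, ((j + 1 : ℕ) : ℝ≥0∞) ≤ stake y N k Y := by
    intro j
    induction j with
    | zero => exact ⟨0, by simp [stake]⟩
    | succ j ih =>
      obtain ⟨k, hk⟩ := ih
      obtain ⟨n, hn, hYn⟩ := hy (N + k)
      obtain ⟨l, rfl⟩ := Nat.exists_eq_add_of_le (show N ≤ n by omega)
      have hkl : ((j + 1 : ℕ) : ℝ≥0∞) ≤ stake y N l Y :=
        hk.trans (hmono (by omega))
      refine ⟨l + 1, ?_⟩
      rw [hsucc, if_pos hYn, two_mul, Nat.cast_succ]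
      exact add_le_add hkl (le_trans (by simp) hkl)
  refine ENNReal.tendsto_nhds_top fun j => ?_
  obtain ⟨k, hk⟩ := hunbdd j
  filter_upwards [eventually_ge_atTop k] with l hl
  exact (Nat.cast_lt.2 j.lt_succ_self).trans_le (hk.trans (hmono hl))

lemma measure_Rset_diff_Rset_succ {ω : CEnv} (hω : IsCookieEnv ω) {x₀ : ℤ}
    {P : Measure (ℕ → ℤ)} (hP : IsERWLaw ω x₀ P) (y : ℤ) :
    P (Rset y \ Rset (y + 1)) = 0 := by
  have hfinite : ∀ N, ∀ᵐ Y ∂P, liminf (fun k => stake y N k Y) atTop < ∞ := by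
    intro N
    refine ae_lt_top (.liminf fun k => measurable_stake y N k) (ne_top_of_le_ne_top
      ENNReal.one_ne_top ((lintegral_liminf_le fun k => measurable_stake y N k).trans ?_))
    exact (liminf_le_liminf (.of_forall fun k => lintegral_stake_le_one hω hP y N k)).trans
      (by simp)
  refine measure_mono_null ?_ (ae_all_iff.2 hfinite)
  rintro Y ⟨hy, hy'⟩ hlt
  simp only [Rset, mem_ofPred_eq, not_forall, not_exists, not_and] at hy'
  obtain ⟨N, hN⟩ := hy'
  exact (hlt N).ne (tendsto_stake_top hy hN).liminf_eq

/-- Lemma 4. For `y < z` and any starting point `x`,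
`P_{x,ω}`-a.s. `R_y ⊆ R_z`. -/
theorem erw_Ry_subset_Rz (ω : CEnv) (hω : IsCookieEnv ω) (x y z : ℤ) (hyz : y < z)
    (P : Measure (ℕ → ℤ)) (hP : IsERWLaw ω x P) :
    P (Rset y \ Rset z) = 0 := by
  induction z, hyz using Int.leInduction with
  | base => exact measure_Rset_diff_Rset_succ hω hP y
  | succ z _ ih =>
    exact measure_mono_null (sdiff_triangle _ (Rset z) _)
      (measure_union_null ih (measure_Rset_diff_Rset_succ hω hP z))

end
end
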